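/- Let a be a sequence of positive integers. Then a is realized by a group endomorphism of a locally nilpotent group if and only if for every prime p the sequence n ↦ p^(ν_p(a(n))) of p-parts of a is realized by a group endomorphism of a locally nilpotent group. -/

import Mathlib

open Function

/-- Every finitely generated subgroup is nilpotent. -/
def IsLocallyNilpotent (G : Type*) [Group G] : Prop :=
  ∀ H : Subgroup G, H.FG → Group.IsNilpotent H

theorem Group.IsNilpotent.of_injective {G K : Type*} [Group G] [Group K] [Group.IsNilpotent K]
    (f : G →* K) (hf : Injective f) : Group.IsNilpotent G :=
  Subgroup.isNilpotent_of_ker_le_center f (by simp [(MonoidHom.ker_eq_bot_iff f).2 hf])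

theorem IsLocallyNilpotent.subgroup {G : Type*} [Group G] (hG : IsLocallyNilpotent G)
    (S : Subgroup G) : IsLocallyNilpotent S := fun H hH => by
  have := (Group.fg_iff_subgroup_fg H).2 hH
  let f := S.subtype.comp H.subtype
  have := hG f.range ((Group.fg_iff_subgroup_fg _).1 inferInstance)
  exact .of_injective f.rangeRestrict
    (f.rangeRestrict_injective_iff.2 (S.subtype_injective.comp H.subtype_injective))

theorem Sylow.mem_iff_exists_pow_eq_one {K : Type*} [Group K] [Finite K] [Group.IsNilpotent K]
    {p : ℕ} [Fact p.Prime] (P : Sylow p K) {x : K} : x ∈ P ↔ ∃ k : ℕ, x ^ p ^ k = 1 := by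
  constructor
  · intro hx
    obtain ⟨k, hk⟩ := P.isPGroup' ⟨x, hx⟩
    exact ⟨k, congrArg Subtype.val hk⟩
  · rintro ⟨k, hk⟩
    have hz : IsPGroup p (Subgroup.zpowers x) := by
      rintro ⟨y, m, rfl⟩
      refine ⟨k, Subtype.ext ?_⟩
      change (x ^ m) ^ p ^ k = 1
      rw [← zpow_natCast, zpow_comm, zpow_natCast, hk, one_zpow]
    obtain ⟨Q, hQ⟩ := hz.exists_le_sylow
    have hiff := (Group.isNilpotent_of_finite_tfae (G := K)).out 0 3
    have hn : P.Normal := hiff.1 ‹_› p ‹_› P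
    have := @Unique.instSubsingleton _ (P.unique_of_normal hn)
    rw [Subsingleton.elim P Q]
    exact hQ (Subgroup.mem_zpowers x)

section Endomorphism

variable {G : Type*} [Group G] (θ : G →* G)

/-- The subgroup of points fixed by the `n`-th iterate of an endomorphism. -/
def iterateFixed (n : ℕ) : Subgroup G where
  carrier := {x | θ^[n] x = x}
  one_mem' := iterate_map_one θ n
  mul_mem' {x y} hx hy := by
    change θ^[n] (x * y) = x * y
    rw [iterate_map_mul, hx, hy]
  inv_mem' {x} hx := by
    change θ^[n] x⁻¹ = x⁻¹
    rw [iterate_map_inv, hx]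

variable {θ}

theorem mem_iterateFixed {n : ℕ} {x : G} : x ∈ iterateFixed θ n ↔ θ^[n] x = x := Iff.rfl

theorem mem_iterateFixed_of_dvd {m n : ℕ} (h : m ∣ n) {x : G} (hx : x ∈ iterateFixed θ m) :
    x ∈ iterateFixed θ n :=
  IsPeriodicPt.trans_dvd (f := θ) hx h

theorem map_mem_iterateFixed {n : ℕ} {x : G} (hx : x ∈ iterateFixed θ n) :
    θ x ∈ iterateFixed θ n :=
  IsPeriodicPt.apply (f := θ) hx

variable (θ)

/-- The subgroup of periodic points of an endomorphism. -/
def periodicSubgroup : Subgroup G where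
  carrier := {x | ∃ n, 1 ≤ n ∧ x ∈ iterateFixed θ n}
  one_mem' := ⟨1, le_rfl, one_mem _⟩
  mul_mem' := by
    rintro x y ⟨m, hm, hx⟩ ⟨n, hn, hy⟩
    exact ⟨m * n, Nat.mul_pos hm hn, mul_mem (mem_iterateFixed_of_dvd (dvd_mul_right m n) hx)
      (mem_iterateFixed_of_dvd (dvd_mul_left n m) hy)⟩
  inv_mem' := by
    rintro x ⟨n, hn, hx⟩
    exact ⟨n, hn, inv_mem hx⟩

/-- The periodic points of `p`-power order, when the fixed subgroups are finite and nilpotent. -/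
def primaryPeriodicSubgroup
    (h : ∀ n, 1 ≤ n → Finite (iterateFixed θ n) ∧ Group.IsNilpotent (iterateFixed θ n))
    (p : ℕ) [Fact p.Prime] : Subgroup G where
  carrier := {x | x ∈ periodicSubgroup θ ∧ ∃ k : ℕ, x ^ p ^ k = 1}
  one_mem' := ⟨one_mem _, 0, by simp⟩
  mul_mem' := by
    rintro x y ⟨⟨m, hm, hx⟩, k, hk⟩ ⟨⟨n, hn, hy⟩, l, hl⟩
    have hmn : 1 ≤ m * n := Nat.mul_pos hm hn
    have hx' := mem_iterateFixed_of_dvd (dvd_mul_right m n) hx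
    have hy' := mem_iterateFixed_of_dvd (dvd_mul_left n m) hy
    obtain ⟨_, _⟩ := h _ hmn
    let P : Sylow p (iterateFixed θ (m * n)) := default
    have hxP : (⟨x, hx'⟩ : iterateFixed θ (m * n)) ∈ P :=
      P.mem_iff_exists_pow_eq_one.2 ⟨k, Subtype.ext hk⟩
    have hyP : (⟨y, hy'⟩ : iterateFixed θ (m * n)) ∈ P :=
      P.mem_iff_exists_pow_eq_one.2 ⟨l, Subtype.ext hl⟩
    obtain ⟨j, hj⟩ := P.mem_iff_exists_pow_eq_one.1 (mul_mem hxP hyP)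
    exact ⟨⟨m * n, hmn, mul_mem hx' hy'⟩, j, congrArg Subtype.val hj⟩
  inv_mem' := by
    rintro x ⟨hx, k, hk⟩
    exact ⟨inv_mem hx, k, by rw [inv_pow, hk, inv_one]⟩

variable {θ}

theorem map_mem_periodicSubgroup {x : G} (hx : x ∈ periodicSubgroup θ) :
    θ x ∈ periodicSubgroup θ := by
  obtain ⟨n, hn, hx⟩ := hx
  exact ⟨n, hn, map_mem_iterateFixed hx⟩

variable (θ) in
/-- The restriction of an endomorphism to an invariant subgroup. -/
def restrictEnd (S : Subgroup G) (hS : ∀ x ∈ S, θ x ∈ S) : S →* S :=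
  (θ.comp S.subtype).codRestrict S fun x => hS x x.2

theorem restrictEnd_iterate_eq_iff {S : Subgroup G} (hS : ∀ x ∈ S, θ x ∈ S) (n : ℕ) (x : S) :
    (restrictEnd θ S hS)^[n] x = x ↔ (x : G) ∈ iterateFixed θ n := by
  have h : Semiconj (Subtype.val : S → G) (restrictEnd θ S hS) θ := fun _ => rfl
  rw [mem_iterateFixed, ← (h.iterate_right n).eq x, Subtype.ext_iff]

theorem isLocallyNilpotent_periodicSubgroup
    (h : ∀ n, 1 ≤ n → Group.IsNilpotent (iterateFixed θ n)) :
    IsLocallyNilpotent (periodicSubgroup θ) := by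
  rintro H ⟨s, rfl⟩
  choose N hN hfix using fun x : periodicSubgroup θ => x.2
  have hpos : 1 ≤ ∏ x ∈ s, N x := Nat.succ_le_of_lt (Finset.prod_pos fun x _ => hN x)
  have hle : Subgroup.closure (s : Set (periodicSubgroup θ)) ≤
      (iterateFixed θ (∏ x ∈ s, N x)).comap (periodicSubgroup θ).subtype := by
    rw [Subgroup.closure_le]
    exact fun x hx => mem_iterateFixed_of_dvd (Finset.dvd_prod_of_mem N hx) (hfix x)
  have := h _ hpos
  refine Group.IsNilpotent.of_injective
    (((periodicSubgroup θ).subtype.comp (Subgroup.subtype _)).codRestrict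
      (iterateFixed θ (∏ x ∈ s, N x)) fun x => hle x.2) fun x y hxy => ?_
  have hval := congrArg Subtype.val hxy
  exact Subtype.ext (Subtype.ext hval)

end Endomorphism

/-- The sequence `a` is realized by an endomorphism of a locally nilpotent group. -/
def IsRealizedLocallyNilpotent (a : ℕ → ℕ) : Prop :=
  ∃ (G : Type) (_ : Group G) (θ : G →* G), IsLocallyNilpotent G ∧
    ∀ n : ℕ, 1 ≤ n → {x : G | θ^[n] x = x}.Finite ∧ {x : G | θ^[n] x = x}.ncard = a n

theorem IsRealizedLocallyNilpotent.primary {a : ℕ → ℕ} (h : IsRealizedLocallyNilpotent a)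
    (p : ℕ) [Fact p.Prime] :
    IsRealizedLocallyNilpotent fun n => p ^ (a n).factorization p := by
  obtain ⟨G, _, θ, hG, hθ⟩ := h
  have hfix : ∀ n, 1 ≤ n → Finite (iterateFixed θ n) ∧ Group.IsNilpotent (iterateFixed θ n) := by
    intro n hn
    have : Finite (iterateFixed θ n) := (hθ n hn).1.to_subtype
    exact ⟨this, hG _ ((Group.fg_iff_subgroup_fg _).1 inferInstance)⟩
  let S := primaryPeriodicSubgroup θ hfix p
  have hS : ∀ x ∈ S, θ x ∈ S := by
    rintro x ⟨hx, k, hk⟩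
    exact ⟨map_mem_periodicSubgroup hx, k, by rw [← map_pow, hk, map_one]⟩
  refine ⟨S, inferInstance, restrictEnd θ S hS, hG.subgroup S, fun n hn => ?_⟩
  obtain ⟨_, _⟩ := hfix n hn
  let P : Sylow p (iterateFixed θ n) := default
  let e : {x : S | (restrictEnd θ S hS)^[n] x = x} ≃ P :=
    { toFun x := ⟨⟨x.1, (restrictEnd_iterate_eq_iff hS n x.1).1 x.2⟩, by
        obtain ⟨k, hk⟩ := x.1.2.2
        exact P.mem_iff_exists_pow_eq_one.2 ⟨k, Subtype.ext hk⟩⟩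
      invFun y := ⟨⟨y.1.1, ⟨n, hn, y.1.2⟩, by
        obtain ⟨k, hk⟩ := P.mem_iff_exists_pow_eq_one.1 y.2
        exact ⟨k, congrArg Subtype.val hk⟩⟩,
        (restrictEnd_iterate_eq_iff hS n _).2 y.1.2⟩
      left_inv _ := rfl
      right_inv _ := rfl }
  have hfin : Finite {x : S | (restrictEnd θ S hS)^[n] x = x} := Finite.of_equiv _ e.symm
  refine ⟨hfin, ?_⟩
  have hcard : Nat.card (iterateFixed θ n) = a n := (hθ n hn).2
  rw [← Nat.card_coe_set_eq, Nat.card_congr e, P.card_eq_multiplicity, hcard]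

section Pi

variable {ι : Type*} {G : ι → Type*} [∀ i, Group (G i)] (θ : ∀ i, G i →* G i)

/-- The coordinatewise endomorphism of a product of groups. -/
def piEnd : (∀ i, G i) →* ∀ i, G i where
  toFun x i := θ i (x i)
  map_one' := by ext; simp
  map_mul' x y := by ext; simp

/-- Points of a product fixed by an iterate are the families of such points. -/
def iterateFixedPiEquiv (n : ℕ) :
    iterateFixed (piEnd θ) n ≃* ∀ i, iterateFixed (θ i) n :=
  have key (x : ∀ i, G i) : x ∈ iterateFixed (piEnd θ) n ↔ ∀ i, x i ∈ iterateFixed (θ i) n := by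
    have h (i : ι) : Semiconj (fun x : ∀ i, G i => x i) (piEnd θ) (θ i) := fun _ => rfl
    simp only [mem_iterateFixed, funext_iff, fun i => ((h i).iterate_right n).eq x]
  { toFun x i := ⟨x.1 i, (key x.1).1 x.2 i⟩
    invFun y := ⟨fun i => y i, (key _).2 fun i => (y i).2⟩
    left_inv _ := rfl
    right_inv _ := rfl
    map_mul' _ _ := rfl }

end Pi

theorem Nat.card_pi_of_card_eq_pow_factorization {F : ℕ → Type*} {m : ℕ} (hm : m ≠ 0)
    (hF : ∀ p, Nat.card (F p) = p ^ m.factorization p) :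
    Nat.card (∀ p, F p) = m := by
  have hone : Nat.card (∀ q : {p // p ∉ m.primeFactors}, F q) = 1 := by
    have (q : {p // p ∉ m.primeFactors}) : Subsingleton (F q) ∧ Nonempty (F q) := by
      rw [← Nat.card_eq_one_iff_unique, hF, Finsupp.notMem_support_iff.1 q.2, pow_zero]
    have hsub (q : {p // p ∉ m.primeFactors}) : Subsingleton (F q) := (this q).1
    have hne (q : {p // p ∉ m.primeFactors}) : Nonempty (F q) := (this q).2
    exact Nat.card_eq_one_iff_unique.2 ⟨inferInstance, inferInstance⟩
  rw [Nat.card_congr (Equiv.piEquivPiSubtypeProd (· ∈ m.primeFactors) F), Nat.card_prod,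
    hone, mul_one, Nat.card_pi]
  simp only [hF]
  rw [Finset.prod_coe_sort m.primeFactors fun p => p ^ m.factorization p]
  exact Nat.prod_factorization_pow_eq_self hm

theorem Group.isNilpotent_pi_of_card_eq_pow_factorization {F : ℕ → Type*} [∀ p, Group (F p)]
    [∀ p, Group.IsNilpotent (F p)] {m : ℕ} (hF : ∀ p, Nat.card (F p) = p ^ m.factorization p) :
    Group.IsNilpotent (∀ p, F p) := by
  refine Group.isNilpotent_pi_of_bounded_class (m.primeFactors.sup fun p =>
    Group.nilpotencyClass (F p)) fun p => ?_
  by_cases hp : p ∈ m.primeFactors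
  · exact Finset.le_sup (f := fun p => Group.nilpotencyClass (F p)) hp
  · have : Nat.card (F p) = 1 := by
      rw [hF, Finsupp.notMem_support_iff.1 hp, pow_zero]
    rw [Group.nilpotencyClass_zero_iff_subsingleton.2 (Nat.card_eq_one_iff_unique.1 this).1]
    exact Nat.zero_le _

theorem IsRealizedLocallyNilpotent.of_primary {a : ℕ → ℕ} (ha : ∀ n, 1 ≤ n → 0 < a n)
    (h : ∀ p, IsRealizedLocallyNilpotent fun n => p ^ (a n).factorization p) :
    IsRealizedLocallyNilpotent a := by
  choose G hGrp θ hG hθ using h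
  have hcard : ∀ n, 1 ≤ n → ∀ p,
      Nat.card (iterateFixed (θ p) n) = p ^ (a n).factorization p :=
    fun n hn p => (hθ p n hn).2
  have hcard' : ∀ n, 1 ≤ n → Nat.card (iterateFixed (piEnd θ) n) = a n := fun n hn => by
    rw [Nat.card_congr (iterateFixedPiEquiv θ n).toEquiv]
    exact Nat.card_pi_of_card_eq_pow_factorization (ha n hn).ne' (hcard n hn)
  have hnil : ∀ n, 1 ≤ n → Group.IsNilpotent (iterateFixed (piEnd θ) n) := fun n hn => by
    have (p : ℕ) : Group.IsNilpotent (iterateFixed (θ p) n) := by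
      have : Finite (iterateFixed (θ p) n) := (hθ p n hn).1.to_subtype
      exact hG p _ ((Group.fg_iff_subgroup_fg _).1 inferInstance)
    have := Group.isNilpotent_pi_of_card_eq_pow_factorization (hcard n hn)
    exact Group.nilpotent_of_mulEquiv (iterateFixedPiEquiv θ n).symm
  let S := periodicSubgroup (piEnd θ)
  have hS : ∀ x ∈ S, piEnd θ x ∈ S := fun _ => map_mem_periodicSubgroup
  refine ⟨S, inferInstance, restrictEnd (piEnd θ) S hS,
    isLocallyNilpotent_periodicSubgroup hnil, fun n hn => ?_⟩
  let e : {x : S | (restrictEnd (piEnd θ) S hS)^[n] x = x} ≃ iterateFixed (piEnd θ) n :=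
    { toFun x := ⟨x.1, (restrictEnd_iterate_eq_iff hS n x.1).1 x.2⟩
      invFun y := ⟨⟨y.1, n, hn, y.2⟩, (restrictEnd_iterate_eq_iff hS n _).2 y.2⟩
      left_inv _ := rfl
      right_inv _ := rfl }
  have hc : Nat.card {x : S | (restrictEnd (piEnd θ) S hS)^[n] x = x} = a n :=
    (Nat.card_congr e).trans (hcard' n hn)
  exact ⟨Nat.finite_of_card_ne_zero (hc.trans_ne (ha n hn).ne'), hc⟩

theorem isRealizedLocallyNilpotent_one : IsRealizedLocallyNilpotent fun _ => 1 :=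
  ⟨PUnit, inferInstance, MonoidHom.id _, fun _ _ => inferInstance, fun n _ =>
    ⟨Set.toFinite _, by simp [Set.ncard_univ]⟩⟩

/-- A sequence of positive integers is realized by a group endomorphism of a
locally nilpotent group iff for every prime `p` its `p`-part sequence is so realized. -/
theorem stmt_2 (a : ℕ → ℕ) (ha : ∀ n : ℕ, 1 ≤ n → 0 < a n) :
    (∃ (G : Type) (_ : Group G) (θ : G →* G),
        (∀ H : Subgroup G, H.FG → Group.IsNilpotent H) ∧
        ∀ n : ℕ, 1 ≤ n → {x : G | (⇑θ)^[n] x = x}.Finite ∧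
          {x : G | (⇑θ)^[n] x = x}.ncard = a n) ↔
    (∀ p : ℕ, p.Prime →
      ∃ (G : Type) (_ : Group G) (θ : G →* G),
        (∀ H : Subgroup G, H.FG → Group.IsNilpotent H) ∧
        ∀ n : ℕ, 1 ≤ n → {x : G | (⇑θ)^[n] x = x}.Finite ∧
          {x : G | (⇑θ)^[n] x = x}.ncard = p ^ padicValNat p (a n)) := by
  constructor
  · intro h p hp
    have := Fact.mk hp
    simp only [← Nat.factorization_def _ hp]
    exact IsRealizedLocallyNilpotent.primary h p
  · intro h
    refine IsRealizedLocallyNilpotent.of_primary ha fun p => ?_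
    by_cases hp : p.Prime
    · simp only [Nat.factorization_def _ hp]
      exact h p hp
    · simpa only [Nat.factorization_eq_zero_of_not_prime _ hp, pow_zero] using
        isRealizedLocallyNilpotent_one
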